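/- Let T be a triangulation of a convex n-gon (n ≥ 4), and let M be the symmetric n×n matrix with M_{ii} = 0 and M_{ij} = a_{ij} the matching number (the frieze entry) for i ≠ j, where a_{i,i+1} = 1. Then det M = -(-2)^{n-2}. -/

import Mathlib

attribute [local instance] Classical.propDecidable

/-- A triangulation of a convex `n`-gon with vertices labelled by `ZMod n` (in cyclic order):
a maximal collection of pairwise non-crossing diagonals, i.e. `n - 3` of them. -/
structure PolygonTriangulation (n : ℕ) [NeZero n] where
  diags : Finset (ZMod n × ZMod n)
  lt_of_mem : ∀ d ∈ diags, d.1.val < d.2.val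
  not_boundary : ∀ d ∈ diags, d.1.val + 1 < d.2.val ∧ ¬(d.1.val = 0 ∧ d.2.val = n - 1)
  noncrossing : ∀ d ∈ diags, ∀ e ∈ diags,
    ¬(d.1.val < e.1.val ∧ e.1.val < d.2.val ∧ d.2.val < e.2.val)
  card_diags : diags.card = n - 3

/-- `i` and `j` are joined by an edge of the triangulation: a diagonal or a boundary edge. -/
def IsTriEdge {n : ℕ} [NeZero n] (T : PolygonTriangulation n) (i j : ZMod n) : Prop :=
  (i, j) ∈ T.diags ∨ (j, i) ∈ T.diags ∨ j = i + 1 ∨ i = j + 1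

/-- The triangles of a triangulation, as 3-element vertex sets all of whose sides are edges. -/
noncomputable def triangles {n : ℕ} [NeZero n] (T : PolygonTriangulation n) :
    Finset (Finset (ZMod n)) :=
  Finset.univ.filter (fun s => s.card = 3 ∧ ∀ i ∈ s, ∀ j ∈ s, i ≠ j → IsTriEdge T i j)

/-- The number of triangles of the triangulation incident with vertex `v`. -/
noncomputable def triCount {n : ℕ} [NeZero n] (T : PolygonTriangulation n) (v : ZMod n) : ℕ :=
  ((triangles T).filter (fun s => v ∈ s)).card
/-- The set of vertices strictly between `i` and `j` in clockwise cyclic order. -/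
noncomputable def strictInterval (n : ℕ) [NeZero n] (i j : ZMod n) : Finset (ZMod n) :=
  Finset.univ.filter (fun k => k ≠ i ∧ k ≠ j ∧ (k - i).val < (j - i).val)

/-- The number of matchings between the vertices strictly between `i` and `j` and the
triangles of `T`: injective maps assigning to each such vertex a triangle incident with it. -/
noncomputable def matchNum {n : ℕ} [NeZero n] (T : PolygonTriangulation n) (i j : ZMod n) : ℕ :=
  Nat.card {f : strictInterval n i j → {s // s ∈ triangles T} //
    Function.Injective f ∧ ∀ v, (v : ZMod n) ∈ (f v : Finset (ZMod n))}

section VertexMatchings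

variable {α : Type*} [Fintype α]

/-- The injective assignments of an incident block of `B` to each point of `I`, extended by `∅`
outside `I`. -/
noncomputable def vertexMatchings (I : Finset α) (B : Finset (Finset α)) :
    Finset (α → Finset α) :=
  Finset.univ.filter fun f =>
    Set.InjOn f I ∧ (∀ v ∈ I, f v ∈ B ∧ v ∈ f v) ∧ ∀ v, v ∉ I → f v = ∅

lemma mem_vertexMatchings {I : Finset α} {B : Finset (Finset α)} {f : α → Finset α} :
    f ∈ vertexMatchings I B ↔
      (∀ v ∈ I, ∀ w ∈ I, f v = f w → v = w) ∧ (∀ v ∈ I, f v ∈ B ∧ v ∈ f v) ∧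
        ∀ v, v ∉ I → f v = ∅ := by
  simp only [vertexMatchings, Finset.mem_filter, Finset.mem_univ, true_and]
  exact and_congr_left fun _ =>
    ⟨fun h v hv w hw e => h hv hw e, fun h v hv w hw e => h v hv w hw e⟩

lemma card_vertexMatchings_empty (B : Finset (Finset α)) : (vertexMatchings ∅ B).card = 1 := by
  rw [Finset.card_eq_one]
  refine ⟨fun _ => ∅, ?_⟩
  ext f
  simp [mem_vertexMatchings, funext_iff]

lemma card_vertexMatchings_eq_zero_of_uncovered {I : Finset α} {B : Finset (Finset α)} {v : α}
    (hv : v ∈ I) (h : ∀ s ∈ B, v ∉ s) : (vertexMatchings I B).card = 0 := by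
  rw [Finset.card_eq_zero, Finset.eq_empty_iff_forall_notMem]
  intro f hf
  rw [mem_vertexMatchings] at hf
  exact h _ (hf.2.1 v hv).1 (hf.2.1 v hv).2

lemma card_vertexMatchings_eq_zero_of_card_lt {I : Finset α} {B : Finset (Finset α)}
    (h : B.card < I.card) : (vertexMatchings I B).card = 0 := by
  rw [Finset.card_eq_zero, Finset.eq_empty_iff_forall_notMem]
  intro f hf
  rw [mem_vertexMatchings] at hf
  exact absurd (Finset.card_le_card_of_injOn f (fun v hv => (hf.2.1 v hv).1)
    (fun v hv w hw e => hf.1 v hv w hw e)) (by omega)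

lemma card_vertexMatchings_filter_eq {I : Finset α} {B : Finset (Finset α)} {t : Finset α}
    (ht : t ∉ B) {x : α} (hx : x ∈ I) (hxt : x ∈ t) :
    ((vertexMatchings I (insert t B)).filter fun f => f x = t).card =
      (vertexMatchings (I.erase x) B).card := by
  refine Finset.card_bij' (fun f _ => Function.update f x ∅) (fun f _ => Function.update f x t)
    ?_ ?_ ?_ ?_
  · intro f hf
    simp only [Finset.mem_filter, mem_vertexMatchings] at hf ⊢
    obtain ⟨⟨h1, h2, h3⟩, h4⟩ := hf
    refine ⟨?_, ?_, ?_⟩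
    · intro v hv w hw e
      rw [Finset.mem_erase] at hv hw
      rw [Function.update_of_ne hv.1, Function.update_of_ne hw.1] at e
      exact h1 v hv.2 w hw.2 e
    · intro v hv
      rw [Finset.mem_erase] at hv
      rw [Function.update_of_ne hv.1]
      refine ⟨((Finset.mem_insert.1 (h2 v hv.2).1).resolve_left fun e => ?_), (h2 v hv.2).2⟩
      exact hv.1 (h1 v hv.2 x hx (e.trans h4.symm))
    · intro v hv
      by_cases e : v = x
      · subst e; simp
      · rw [Function.update_of_ne e]
        exact h3 v fun h => hv (Finset.mem_erase.2 ⟨e, h⟩)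
  · intro f hf
    simp only [Finset.mem_filter, mem_vertexMatchings] at hf ⊢
    obtain ⟨h1, h2, h3⟩ := hf
    have key : ∀ v ∈ I, v ≠ x → f v ∈ B ∧ v ∈ f v := fun v hv hne =>
      h2 v (Finset.mem_erase.2 ⟨hne, hv⟩)
    refine ⟨⟨?_, ?_, ?_⟩, by simp⟩
    · intro v hv w hw e
      by_cases hvx : v = x <;> by_cases hwx : w = x
      · rw [hvx, hwx]
      · rw [hvx, Function.update_self, Function.update_of_ne hwx] at e
        exact absurd (e ▸ (key w hw hwx).1) ht
      · rw [hwx, Function.update_self, Function.update_of_ne hvx] at e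
        exact absurd (e ▸ (key v hv hvx).1) ht
      · rw [Function.update_of_ne hwx, Function.update_of_ne hvx] at e
        exact h1 v (Finset.mem_erase.2 ⟨hvx, hv⟩) w (Finset.mem_erase.2 ⟨hwx, hw⟩) e
    · intro v hv
      by_cases hvx : v = x
      · rw [hvx, Function.update_self]
        exact ⟨Finset.mem_insert_self _ _, hxt⟩
      · rw [Function.update_of_ne hvx]
        exact ⟨Finset.mem_insert_of_mem (key v hv hvx).1, (key v hv hvx).2⟩
    · intro v hv
      have hvx : v ≠ x := fun h => hv (h ▸ hx)
      rw [Function.update_of_ne hvx]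
      exact h3 v fun h => hv (Finset.mem_of_mem_erase h)
  · intro f hf
    simp only [Finset.mem_filter] at hf
    simp [← hf.2]
  · intro f hf
    rw [mem_vertexMatchings] at hf
    simp [← hf.2.2 x (by simp)]

/-- Matchings into `insert t B` are sorted by the point, if any, that is sent to `t`. -/
lemma card_vertexMatchings_insert (I : Finset α) {B : Finset (Finset α)} {t : Finset α}
    (ht : t ∉ B) :
    (vertexMatchings I (insert t B)).card =
      (vertexMatchings I B).card +
        ∑ x ∈ I.filter (· ∈ t), (vertexMatchings (I.erase x) B).card := by
  have hU : vertexMatchings I (insert t B) = vertexMatchings I B ∪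
      (I.filter (· ∈ t)).biUnion fun x =>
        (vertexMatchings I (insert t B)).filter fun f => f x = t := by
    ext f
    simp only [Finset.mem_union, Finset.mem_biUnion, Finset.mem_filter]
    constructor
    · intro hf
      by_cases h : ∃ x ∈ I, f x = t
      · obtain ⟨x, hx, e⟩ := h
        exact Or.inr ⟨x, ⟨hx, e ▸ ((mem_vertexMatchings.1 hf).2.1 x hx).2⟩, hf, e⟩
      · left
        push Not at h
        rw [mem_vertexMatchings] at hf ⊢
        exact ⟨hf.1, fun v hv =>
          ⟨(Finset.mem_insert.1 (hf.2.1 v hv).1).resolve_left (h v hv), (hf.2.1 v hv).2⟩, hf.2.2⟩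
    · rintro (hf | ⟨x, -, hf, -⟩)
      · rw [mem_vertexMatchings] at hf ⊢
        exact ⟨hf.1, fun v hv =>
          ⟨Finset.mem_insert_of_mem (hf.2.1 v hv).1, (hf.2.1 v hv).2⟩, hf.2.2⟩
      · exact hf
  rw [hU, Finset.card_union_of_disjoint, Finset.card_biUnion]
  · congr 1
    refine Finset.sum_congr rfl fun x hx => ?_
    rw [Finset.mem_filter] at hx
    exact card_vertexMatchings_filter_eq ht hx.1 hx.2
  · intro x hx y hy hxy
    rw [Function.onFun, Finset.disjoint_left]
    intro f hf hf'
    simp only [Finset.mem_coe, Finset.mem_filter, mem_vertexMatchings] at hx hy hf hf'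
    exact hxy (hf.1.1 x hx.1 y hy.1 (hf.2.trans hf'.2.symm))
  · rw [Finset.disjoint_left]
    intro f hf hf'
    simp only [Finset.mem_biUnion, Finset.mem_filter, mem_vertexMatchings] at hf hf'
    obtain ⟨x, hx, -, e⟩ := hf'
    exact ht (e ▸ (hf.2.1 x hx.1).1)

lemma card_vertexMatchings_insert_of_forced {I : Finset α} {B : Finset (Finset α)}
    {t : Finset α} {v : α} (hv : v ∈ I) (hvt : v ∈ t) (h : ∀ s ∈ B, v ∉ s) :
    (vertexMatchings I (insert t B)).card = (vertexMatchings (I.erase v) B).card := by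
  rw [card_vertexMatchings_insert I fun ht => h t ht hvt,
    card_vertexMatchings_eq_zero_of_uncovered hv h, zero_add]
  refine Finset.sum_eq_single_of_mem v (by simp [hv, hvt]) fun x _ hxv => ?_
  exact card_vertexMatchings_eq_zero_of_uncovered (v := v) (by simp [hv, hxv.symm]) h

lemma card_vertexMatchings_insert_of_disjoint {I : Finset α} {B : Finset (Finset α)}
    {t : Finset α} (ht : t ∉ B) (h : ∀ x ∈ I, x ∉ t) :
    (vertexMatchings I (insert t B)).card = (vertexMatchings I B).card := by
  rw [card_vertexMatchings_insert I ht, Finset.filter_false_of_mem h]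
  simp

lemma card_vertexMatchings_insert_of_unique {I : Finset α} {B : Finset (Finset α)}
    {t : Finset α} (ht : t ∉ B) {x : α} (hx : x ∈ I) (hxt : x ∈ t)
    (h : ∀ y ∈ I, y ∈ t → y = x) :
    (vertexMatchings I (insert t B)).card =
      (vertexMatchings I B).card + (vertexMatchings (I.erase x) B).card := by
  have : I.filter (· ∈ t) = {x} := by
    ext y
    simp only [Finset.mem_filter, Finset.mem_singleton]
    exact ⟨fun hy => h y hy.1 hy.2, fun e => e ▸ ⟨hx, hxt⟩⟩
  rw [card_vertexMatchings_insert I ht, this, Finset.sum_singleton]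

end VertexMatchings

section EarBuilt

variable {α : Type*} [LinearOrder α]

/-- `k` lies strictly between `i` and `j` in the cyclic order, for `i ≠ j`. -/
def CycBetween (i j k : α) : Prop := (i < k ∧ k < j) ∨ (j < i ∧ (i < k ∨ k < j))

/-- The elements of `S` strictly between `i` and `j` in the cyclic order. -/
noncomputable def cycArc (S : Finset α) (i j : α) : Finset α := S.filter (CycBetween i j)

/-- `x < y` are consecutive elements of `S`. -/
def ConsecutiveIn (S : Finset α) (x y : α) : Prop :=
  x ∈ S ∧ y ∈ S ∧ x < y ∧ ∀ z ∈ S, z ≤ x ∨ y ≤ z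

/-- The vertex sets and triangle sets of polygons obtained from a digon by successively gluing
triangles along boundary edges. -/
inductive EarBuilt : Finset α → Finset (Finset α) → Prop
  | digon (a b : α) (hab : a < b) : EarBuilt {a, b} ∅
  | ear (S : Finset α) (B : Finset (Finset α)) (p v q : α) (h : EarBuilt S B)
      (hpq : ConsecutiveIn S p q) (hpv : p < v) (hvq : v < q) :
      EarBuilt (insert v S) (insert {p, v, q} B)

lemma EarBuilt.subset {S : Finset α} {B : Finset (Finset α)} (h : EarBuilt S B) :
    ∀ s ∈ B, s ⊆ S := by
  induction h with
  | digon a b hab => simp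
  | ear S B p v q h hpq hpv hvq ih =>
    intro s hs
    rcases Finset.mem_insert.1 hs with rfl | hs
    · intro x
      simp only [Finset.mem_insert, Finset.mem_singleton]
      rintro (rfl | rfl | rfl)
      · exact Or.inr hpq.1
      · exact Or.inl rfl
      · exact Or.inr hpq.2.1
    · exact (ih s hs).trans (Finset.subset_insert _ _)

lemma ConsecutiveIn.notMem {S : Finset α} {p q v : α} (h : ConsecutiveIn S p q) (hpv : p < v)
    (hvq : v < q) : v ∉ S := fun hv =>
  (h.2.2.2 v hv).elim (fun h => absurd hpv h.not_gt) fun h => absurd hvq h.not_gt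

lemma EarBuilt.card_add_two {S : Finset α} {B : Finset (Finset α)} (h : EarBuilt S B) :
    B.card + 2 = S.card := by
  induction h with
  | digon a b hab => rw [Finset.card_pair hab.ne]; rfl
  | ear S B p v q h hpq hpv hvq ih =>
    have hv := hpq.notMem hpv hvq
    rw [Finset.card_insert_of_notMem hv, Finset.card_insert_of_notMem, ← ih]
    exact fun ht => hv (h.subset _ ht (by simp))

variable [Fintype α]

lemma EarBuilt.card_vertexMatchings_erase_erase {S : Finset α} {B : Finset (Finset α)}
    (h : EarBuilt S B) : ∀ x y, ConsecutiveIn S x y →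
      (vertexMatchings ((S.erase x).erase y) B).card = 1 := by
  induction h with
  | digon a b hab =>
    intro x y hxy
    have : (({a, b} : Finset α).erase x).erase y = ∅ := by
      ext z
      simp only [ConsecutiveIn, Finset.mem_erase, Finset.mem_insert, Finset.mem_singleton] at *
      grind
    rw [this, card_vertexMatchings_empty]
  | ear S B p v q h hpq hpv hvq ih =>
    intro x y hxy
    have hv := hpq.notMem hpv hvq
    have hun : ∀ s ∈ B, v ∉ s := fun s hs hvs => hv (h.subset s hs hvs)
    have ht : ({p, v, q} : Finset α) ∉ B := fun ht => hun _ ht (by simp)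
    have hcard := h.card_add_two
    obtain ⟨hp, hq, hlt, hgap⟩ := hpq
    by_cases hxv : x = v
    · have hyq : y = q := by
        have := hxy.2.2.2 q (Finset.mem_insert_of_mem hq)
        have := hxy.2.1
        have := hxy.2.2.1
        grind
      subst hxv hyq
      rw [Finset.erase_insert hv, card_vertexMatchings_insert_of_unique ht (x := p),
        card_vertexMatchings_eq_zero_of_card_lt, Finset.erase_right_comm,
        ih _ _ ⟨hp, hq, hlt, hgap⟩]
      · rw [Finset.card_erase_of_mem hq]; omega
      · simp [hp, hlt.ne]
      · simp
      · simp only [Finset.mem_erase, Finset.mem_insert, Finset.mem_singleton]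
        grind
    by_cases hyv : y = v
    · have hxp : x = p := by
        have := hxy.2.2.2 p (Finset.mem_insert_of_mem hp)
        have := hxy.1
        have := hxy.2.2.1
        grind
      subst hyv hxp
      rw [Finset.erase_right_comm, Finset.erase_insert hv,
        card_vertexMatchings_insert_of_unique ht (x := q),
        card_vertexMatchings_eq_zero_of_card_lt, ih _ _ ⟨hp, hq, hlt, hgap⟩]
      · rw [Finset.card_erase_of_mem hp]; omega
      · simp [hq, hlt.ne']
      · simp
      · simp only [Finset.mem_erase, Finset.mem_insert, Finset.mem_singleton]
        grind
    · rw [card_vertexMatchings_insert_of_forced (v := v) _ (by simp) hun]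
      · have : (((insert v S).erase x).erase y).erase v = (S.erase x).erase y := by
          ext z
          simp only [Finset.mem_erase, Finset.mem_insert]
          grind
        rw [this]
        refine ih x y ⟨?_, ?_, hxy.2.2.1, fun z hz => hxy.2.2.2 z (Finset.mem_insert_of_mem hz)⟩
        · exact (Finset.mem_insert.1 hxy.1).resolve_left hxv
        · exact (Finset.mem_insert.1 hxy.2.1).resolve_left hyv
      · simp [Ne.symm hxv, Ne.symm hyv]

section Ear

variable {S : Finset α} {B : Finset (Finset α)} {p v q : α}

lemma card_vertexMatchings_cycArc_ear (hpq : ConsecutiveIn S p q)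
    (hpv : p < v) (hvq : v < q) (hB : ∀ s ∈ B, s ⊆ S) {i j : α} (hi : i ∈ S) (hj : j ∈ S) :
    (vertexMatchings (cycArc (insert v S) i j) (insert {p, v, q} B)).card =
      (vertexMatchings (cycArc S i j) B).card := by
  have hv := hpq.notMem hpv hvq
  have hun : ∀ s ∈ B, v ∉ s := fun s hs hvs => hv (hB s hs hvs)
  have ht : ({p, v, q} : Finset α) ∉ B := fun ht => hun _ ht (by simp)
  obtain ⟨hp, hq, hlt, hgap⟩ := hpq
  by_cases hc : CycBetween i j v
  · rw [card_vertexMatchings_insert_of_forced (v := v) _ (by simp) hun]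
    · congr 2
      ext z
      simp only [cycArc, Finset.mem_erase, Finset.mem_filter, Finset.mem_insert]
      grind
    · simp [cycArc, hc]
  · have : cycArc (insert v S) i j = cycArc S i j := by
      ext z
      simp only [cycArc, Finset.mem_filter, Finset.mem_insert]
      grind
    rw [this, card_vertexMatchings_insert_of_disjoint ht]
    intro x hx
    have := hgap i hi
    have := hgap j hj
    simp only [cycArc, CycBetween, Finset.mem_filter, Finset.mem_insert,
      Finset.mem_singleton] at *
    grind

lemma card_vertexMatchings_cycArc_apex (hpq : ConsecutiveIn S p q)
    (hpv : p < v) (hvq : v < q) (hB : ∀ s ∈ B, s ⊆ S) (hcard : B.card + 2 = S.card)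
    {j : α} (hj : j ∈ S) :
    (vertexMatchings (cycArc (insert v S) v j) (insert {p, v, q} B)).card =
      (if p = j then 0 else (vertexMatchings (cycArc S p j) B).card) +
        (if q = j then 0 else (vertexMatchings (cycArc S q j) B).card) := by
  have hv := hpq.notMem hpv hvq
  have hun : ∀ s ∈ B, v ∉ s := fun s hs hvs => hv (hB s hs hvs)
  have ht : ({p, v, q} : Finset α) ∉ B := fun ht => hun _ ht (by simp)
  obtain ⟨hp, hq, hlt, hgap⟩ := hpq
  by_cases hqj : q = j
  · subst hqj
    have h1 : cycArc (insert v S) v q = ∅ := by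
      ext z
      have := hgap z
      simp only [cycArc, CycBetween, Finset.mem_filter, Finset.mem_insert, Finset.notMem_empty]
      grind
    have h2 : cycArc S p q = ∅ := by
      ext z
      have := hgap z
      simp only [cycArc, CycBetween, Finset.mem_filter, Finset.notMem_empty]
      grind
    rw [h1, h2, card_vertexMatchings_empty, card_vertexMatchings_empty, if_neg hlt.ne,
      if_pos rfl]
  have hgj := hgap j hj
  rw [card_vertexMatchings_insert_of_unique ht (x := q), if_neg hqj]
  · congr 1
    · split_ifs with hpj
      · subst hpj
        have : cycArc (insert v S) v p = S.erase p := by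
          ext z
          have := hgap z
          simp only [cycArc, CycBetween, Finset.mem_filter, Finset.mem_insert, Finset.mem_erase]
          grind
        rw [this, card_vertexMatchings_eq_zero_of_card_lt]
        rw [Finset.card_erase_of_mem hp]; omega
      · congr 2
        ext z
        have := hgap z
        simp only [cycArc, CycBetween, Finset.mem_filter, Finset.mem_insert]
        grind
    · congr 2
      ext z
      have := hgap z
      simp only [cycArc, CycBetween, Finset.mem_filter, Finset.mem_insert, Finset.mem_erase]
      grind
  · simp only [cycArc, CycBetween, Finset.mem_filter, Finset.mem_insert]
    grind
  · simp
  · intro y hy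
    simp only [cycArc, CycBetween, Finset.mem_filter, Finset.mem_insert,
      Finset.mem_singleton] at *
    grind

end Ear

/-- The matrix of matching numbers of the polygon on `S` with triangles `B`, extended by the
identity matrix outside `S`. -/
noncomputable def matchingMatrix (S : Finset α) (B : Finset (Finset α)) : Matrix α α ℤ :=
  Matrix.of fun i j =>
    if i ∈ S ∧ j ∈ S then
      if i = j then 0 else ((vertexMatchings (cycArc S i j) B).card : ℤ)
    else if i = j then 1 else 0

lemma matchingMatrix_digon {a b : α} (hab : a < b) :
    matchingMatrix {a, b} ∅ = Equiv.Perm.permMatrix ℤ (Equiv.swap a b) := by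
  have h1 : cycArc {a, b} a b = ∅ := by
    ext z
    simp only [cycArc, CycBetween, Finset.mem_filter, Finset.mem_insert, Finset.mem_singleton,
      Finset.notMem_empty]
    grind
  have h2 : cycArc {a, b} b a = ∅ := by
    ext z
    simp only [cycArc, CycBetween, Finset.mem_filter, Finset.mem_insert, Finset.mem_singleton,
      Finset.notMem_empty]
    grind
  ext i j
  simp only [matchingMatrix, Matrix.of_apply, Equiv.Perm.permMatrix, PEquiv.toMatrix_apply,
    Equiv.toPEquiv_apply, Option.mem_some_iff, Equiv.swap_apply_def, Finset.mem_insert,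
    Finset.mem_singleton]
  by_cases hia : i = a
  · subst hia
    by_cases hj : j = b
    · subst hj; simp [h1, card_vertexMatchings_empty, hab.ne]
    · by_cases hji : j = i
      · subst hji; simp [hab.ne']
      · simp [hj, hji, Ne.symm hji, Ne.symm hj]
  by_cases hib : i = b
  · subst hib
    by_cases hj : j = a
    · subst hj; simp [h2, card_vertexMatchings_empty, hab.ne']
    · by_cases hji : j = i
      · subst hji; simp [hab.ne, hab.ne']
      · simp [hj, hji, Ne.symm hji, Ne.symm hj, hia]
  simp [hia, hib]

lemma det_matchingMatrix_ear {S : Finset α} {B : Finset (Finset α)} {p v q : α}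
    (h : EarBuilt S B) (hpq : ConsecutiveIn S p q) (hpv : p < v) (hvq : v < q) :
    (matchingMatrix (insert v S) (insert {p, v, q} B)).det = -2 * (matchingMatrix S B).det := by
  set M := matchingMatrix (insert v S) (insert {p, v, q} B) with hM
  set N := matchingMatrix S B with hN
  have hv := hpq.notMem hpv hvq
  have hE := EarBuilt.ear S B p v q h hpq hpv hvq
  have hS : ∀ i ∈ S, ∀ j ∈ S, M i j = N i j := by
    intro i hi j hj
    simp only [hM, hN, matchingMatrix, Matrix.of_apply, hi, hj, Finset.mem_insert, or_true,
      and_self, if_true, card_vertexMatchings_cycArc_ear hpq hpv hvq h.subset hi hj]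
  have hout : ∀ i j, ¬(i ∈ insert v S ∧ j ∈ insert v S) → M i j = N i j := by
    intro i j hij
    have : ¬(i ∈ S ∧ j ∈ S) := fun h =>
      hij ⟨Finset.mem_insert_of_mem h.1, Finset.mem_insert_of_mem h.2⟩
    simp only [hM, hN, matchingMatrix, Matrix.of_apply, if_neg hij, if_neg this]
  have hNv : ∀ j, N v j = (Pi.single v 1 : α → ℤ) j := by
    intro j
    simp [hN, matchingMatrix, hv, Pi.single_apply, eq_comm]
  have hpS := hpq.1
  have hqS := hpq.2.1
  have hrow : ∀ j, M v j = M p j + M q j + -2 * (Pi.single v 1 : α → ℤ) j := by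
    intro j
    by_cases hjv : j = v
    · subst hjv
      have h1 : cycArc (insert j S) p j = ∅ := by
        ext z
        have := hpq.2.2.2 z
        simp only [cycArc, CycBetween, Finset.mem_filter, Finset.mem_insert,
          Finset.notMem_empty]
        grind
      have h2 : cycArc (insert j S) q j = ((insert j S).erase j).erase q := by
        ext z
        have := hpq.2.2.2 z
        simp only [cycArc, CycBetween, Finset.mem_filter, Finset.mem_insert, Finset.mem_erase]
        grind
      have h3 := hE.card_vertexMatchings_erase_erase j q
        ⟨Finset.mem_insert_self _ _, Finset.mem_insert_of_mem hqS, hvq, fun z hz => by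
          have := hpq.2.2.2 z
          rw [Finset.mem_insert] at hz
          grind⟩
      rw [← h2] at h3
      simp [hM, matchingMatrix, hpS, hqS, h1, h3, card_vertexMatchings_empty, hpv.ne,
        hvq.ne']
    · by_cases hj : j ∈ S
      · have := card_vertexMatchings_cycArc_apex hpq hpv hvq h.subset h.card_add_two hj
        rw [hS p hpS j hj, hS q hqS j hj]
        simp only [hM, hN, matchingMatrix, Matrix.of_apply, hj, hpS, hqS, Finset.mem_insert,
          true_or, or_true, and_self, if_true, this, Pi.single_apply, if_neg hjv,
          if_neg (Ne.symm hjv)]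
        push_cast
        ring
      · have hj' : j ∉ insert v S := by simp [hjv, hj]
        rw [hout v j (by simp [hj']), hout p j (by simp [hj']), hout q j (by simp [hj'])]
        have hpj : p ≠ j := fun e => hj (e ▸ hpS)
        have hqj : q ≠ j := fun e => hj (e ▸ hqS)
        simp [hN, matchingMatrix, hj, hjv, Ne.symm hjv, hpj, hqj]
  have hMv : M.updateRow v (M p + M q + (-2 : ℤ) • Pi.single v 1) = M := by
    have : M p + M q + (-2 : ℤ) • Pi.single v 1 = M v := by
      ext j
      simp [hrow j]
    rw [this, Matrix.updateRow_eq_self]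
  have hz : ∀ w, w ≠ v → (M.updateRow v (M w)).det = 0 := fun w hw =>
    Matrix.det_zero_of_row_eq hw (by
      rw [Matrix.updateRow_ne hw, Matrix.updateRow_self])
  have hdet : M.det = -2 * (M.updateRow v (Pi.single v 1)).det := by
    conv_lhs => rw [← hMv]
    rw [Matrix.det_updateRow_add, Matrix.det_updateRow_add, Matrix.det_updateRow_smul,
      hz p hpv.ne, hz q hvq.ne']
    ring
  rw [hdet]
  congr 1
  refine Matrix.det_eq_of_forall_row_eq_smul_add_const (fun i => if i = v then 0 else M i v) v
    (if_pos rfl) fun i j => ?_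
  rw [hNv]
  by_cases hi : i = v
  · subst hi
    simp [hNv]
  · rw [Matrix.updateRow_ne hi, if_neg hi]
    by_cases hj : j = v
    · subst hj
      have : N i j = 0 := by simp [hN, matchingMatrix, hv, hi]
      simp [this]
    · rw [Pi.single_eq_of_ne hj, mul_zero, add_zero]
      by_cases hij : i ∈ S ∧ j ∈ S
      · exact hS i hij.1 j hij.2
      · exact hout i j (by simpa [hi, hj] using hij)

theorem EarBuilt.det_matchingMatrix {S : Finset α} {B : Finset (Finset α)} (h : EarBuilt S B) :
    (matchingMatrix S B).det = -(-2) ^ (S.card - 2) := by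
  induction h with
  | digon a b hab =>
    rw [matchingMatrix_digon hab, Matrix.det_permutation, Equiv.Perm.sign_swap hab.ne,
      Finset.card_pair hab.ne]
    simp
  | ear S B p v q h hpq hpv hvq ih =>
    rw [det_matchingMatrix_ear h hpq hpv hvq, ih,
      Finset.card_insert_of_notMem (hpq.notMem hpv hvq), ← h.card_add_two]
    simp only [Nat.add_sub_cancel, Nat.add_right_comm _ 2 1]
    ring

end EarBuilt

section Dissection

variable {α : Type*} [LinearOrder α]

/-- `D` is a set of pairwise noncrossing diagonals of the convex polygon with vertex set `S`. -/
structure NoncrossingOn (S : Finset α) (D : Finset (α × α)) : Prop where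
  left_mem : ∀ d ∈ D, d.1 ∈ S
  right_mem : ∀ d ∈ D, d.2 ∈ S
  exists_between : ∀ d ∈ D, ∃ x ∈ S, d.1 < x ∧ x < d.2
  exists_outside : ∀ d ∈ D, ∃ x ∈ S, x < d.1 ∨ d.2 < x
  not_crossing : ∀ d ∈ D, ∀ e ∈ D, ¬(d.1 < e.1 ∧ e.1 < d.2 ∧ d.2 < e.2)

/-- `i < j` are joined by a diagonal in `D` or by a side of the polygon on `S`. -/
def IsChord (S : Finset α) (D : Finset (α × α)) (i j : α) : Prop :=
  (i, j) ∈ D ∨ (∀ x ∈ S, x ≤ i ∨ j ≤ x) ∨ ∀ x ∈ S, i ≤ x ∧ x ≤ j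

/-- A vertex `v` which is not an endpoint of `D` and which is enclosed by an innermost chord. -/
lemma NoncrossingOn.exists_isolated {S : Finset α} {D : Finset (α × α)} (h : NoncrossingOn S D)
    (hS : 3 ≤ S.card) : ∃ a ∈ S, ∃ v ∈ S, ∃ b ∈ S, a < v ∧ v < b ∧
      ((a, b) ∈ D ∨ ∀ x ∈ S, a ≤ x ∧ x ≤ b) ∧
      ∀ d ∈ D, d.1 ≠ v ∧ d.2 ≠ v ∧ (d.1 < v → v < d.2 → d.1 ≤ a ∧ b ≤ d.2) := by
  have hne : S.Nonempty := Finset.card_pos.1 (by omega)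
  obtain ⟨m, hmS, hm⟩ : ∃ m ∈ S, ∀ x ∈ S, m ≤ x := ⟨_, S.min'_mem hne, S.min'_le⟩
  obtain ⟨M, hMS, hM⟩ : ∃ M ∈ S, ∀ x ∈ S, x ≤ M := ⟨_, S.max'_mem hne, S.le_max'⟩
  have hbound : ∀ x ∈ S, m ≤ x ∧ x ≤ M := fun x hx => ⟨hm x hx, hM x hx⟩
  obtain ⟨⟨a, b⟩, hab, hmin⟩ := Finset.exists_min_image (insert (m, M) D)
    (fun d => (S.filter fun x => d.1 < x ∧ x < d.2).card) ⟨_, Finset.mem_insert_self _ _⟩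
  have ha : a ∈ S := by
    rcases Finset.mem_insert.1 hab with e | hd
    · rw [(Prod.mk.inj e).1]; exact hmS
    · exact h.left_mem _ hd
  have hb : b ∈ S := by
    rcases Finset.mem_insert.1 hab with e | hd
    · rw [(Prod.mk.inj e).2]; exact hMS
    · exact h.right_mem _ hd
  have hchord : (a, b) ∈ D ∨ ∀ x ∈ S, a ≤ x ∧ x ≤ b := by
    rcases Finset.mem_insert.1 hab with e | hd
    · right
      rw [(Prod.mk.inj e).1, (Prod.mk.inj e).2]
      exact hbound
    · exact Or.inl hd
  have hinner : ∃ v ∈ S, a < v ∧ v < b := by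
    rcases Finset.mem_insert.1 hab with e | hd
    · rw [(Prod.mk.inj e).1, (Prod.mk.inj e).2]
      by_contra! hno
      have hsub : S ⊆ {m, M} := by
        intro x hx
        simp only [Finset.mem_insert, Finset.mem_singleton]
        rcases (hm x hx).eq_or_lt with e | hlt
        · exact Or.inl e.symm
        · exact Or.inr (le_antisymm (hM x hx) (hno x hx hlt))
      have := Finset.card_le_card hsub
      have := Finset.card_le_two (a := m) (b := M)
      omega
    · exact h.exists_between _ hd
  obtain ⟨v, hv, hav, hvb⟩ := hinner
  have hnest : ∀ d ∈ D, a ≤ d.1 → d.2 ≤ b → d = (a, b) := by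
    intro d hd h1 h2
    by_contra hne
    have hlt : d.1 < d.2 := by
      obtain ⟨x, -, hx⟩ := h.exists_between d hd
      exact hx.1.trans hx.2
    refine absurd (hmin d (Finset.mem_insert_of_mem hd)) (not_le.2 (Finset.card_lt_card ?_))
    have hor : a < d.1 ∨ d.2 < b := by
      by_contra! hcon
      exact hne (Prod.ext (le_antisymm hcon.1 h1) (le_antisymm h2 hcon.2))
    rw [Finset.ssubset_iff_of_subset]
    · rcases hor with hlt' | hlt'
      · exact ⟨d.1, by simp [h.left_mem d hd, hlt', hlt.trans_le h2], by simp⟩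
      · exact ⟨d.2, by simp [h.right_mem d hd, hlt', h1.trans_lt hlt], by simp⟩
    · intro x
      simp only [Finset.mem_filter]
      exact fun hx => ⟨hx.1, h1.trans_lt hx.2.1, hx.2.2.trans_le h2⟩
  have hcross : ∀ d ∈ D, (a < d.1 → d.1 < b → d.2 ≤ b) ∧ (a < d.2 → d.2 < b → a ≤ d.1) := by
    intro d hd
    have h1 := hbound _ (h.left_mem d hd)
    have h2 := hbound _ (h.right_mem d hd)
    rcases hchord with hD | hD
    · have := h.not_crossing _ hD d hd
      have := h.not_crossing d hd _ hD
      grind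
    · exact ⟨fun _ _ => (hD _ (h.right_mem d hd)).2, fun _ _ => (hD _ (h.left_mem d hd)).1⟩
  refine ⟨a, ha, v, hv, b, hb, hav, hvb, hchord, fun d hd => ?_⟩
  have h1 := hcross d hd
  have h2 := hnest d hd
  have hlt : d.1 < d.2 := by
    obtain ⟨x, -, hx⟩ := h.exists_between d hd
    exact hx.1.trans hx.2
  have hd2 : d = (a, b) → d.1 = a ∧ d.2 = b := fun e => by rw [e]; exact ⟨rfl, rfl⟩
  refine ⟨?_, ?_, ?_⟩
  · grind
  · grind
  · grind

/-- Deleting a vertex as in `NoncrossingOn.exists_isolated` keeps the diagonals which are not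
turned into a side. -/
lemma NoncrossingOn.erase {S : Finset α} {D D' : Finset (α × α)} (h : NoncrossingOn S D)
    {a v b : α} (ha : a ∈ S) (hb : b ∈ S) (hav : a < v) (hvb : v < b)
    (hD : ∀ d ∈ D, d.1 ≠ v ∧ d.2 ≠ v ∧ (d.1 < v → v < d.2 → d.1 ≤ a ∧ b ≤ d.2))
    (hsub : D' ⊆ D) (hin : (a, b) ∈ D' → ∃ x ∈ S, x ≠ v ∧ a < x ∧ x < b) :
    NoncrossingOn (S.erase v) D' where
  left_mem d hd := Finset.mem_erase.2 ⟨(hD d (hsub hd)).1, h.left_mem d (hsub hd)⟩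
  right_mem d hd := Finset.mem_erase.2 ⟨(hD d (hsub hd)).2.1, h.right_mem d (hsub hd)⟩
  exists_between d hd := by
    obtain ⟨x, hx, h1, h2⟩ := h.exists_between d (hsub hd)
    by_cases hxv : x = v
    · subst hxv
      have h3 := (hD d (hsub hd)).2.2 h1 h2
      by_cases hda : d.1 = a
      · by_cases hdb : d.2 = b
        · obtain ⟨y, hy, hyx, h4, h5⟩ := hin (by rw [← hda, ← hdb]; exact hd)
          exact ⟨y, Finset.mem_erase.2 ⟨hyx, hy⟩, hda ▸ h4, hdb ▸ h5⟩
        · exact ⟨b, Finset.mem_erase.2 ⟨hvb.ne', hb⟩, h1.trans hvb, h3.2.lt_of_ne (Ne.symm hdb)⟩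
      · exact ⟨a, Finset.mem_erase.2 ⟨hav.ne, ha⟩, h3.1.lt_of_ne hda, hav.trans h2⟩
    · exact ⟨x, Finset.mem_erase.2 ⟨hxv, hx⟩, h1, h2⟩
  exists_outside d hd := by
    obtain ⟨x, hx, hxd⟩ := h.exists_outside d (hsub hd)
    by_cases hxv : x = v
    · subst hxv
      rcases hxd with hxd | hxd
      · exact ⟨a, Finset.mem_erase.2 ⟨hav.ne, ha⟩, Or.inl (hav.trans hxd)⟩
      · exact ⟨b, Finset.mem_erase.2 ⟨hvb.ne', hb⟩, Or.inr (hxd.trans hvb)⟩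
    · exact ⟨x, Finset.mem_erase.2 ⟨hxv, hx⟩, hxd⟩
  not_crossing d hd e he := h.not_crossing d (hsub hd) e (hsub he)

lemma NoncrossingOn.card_le {S : Finset α} {D : Finset (α × α)} (h : NoncrossingOn S D) :
    D.card ≤ S.card - 3 := by
  induction hn : S.card using Nat.strong_induction_on generalizing S D with
  | _ n ih =>
    rcases D.eq_empty_or_nonempty with rfl | ⟨d, hd⟩
    · simp
    have hS : 4 ≤ S.card := by
      obtain ⟨x, hx, h1, h2⟩ := h.exists_between d hd
      obtain ⟨y, hy, h3⟩ := h.exists_outside d hd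
      have hl := h.left_mem d hd
      have hr := h.right_mem d hd
      have hsub : ({d.1, d.2, x, y} : Finset α) ⊆ S := by
        intro z
        simp only [Finset.mem_insert, Finset.mem_singleton]
        rintro (rfl | rfl | rfl | rfl) <;> assumption
      refine le_trans (le_of_eq ?_) (Finset.card_le_card hsub)
      rw [Finset.card_insert_of_notMem, Finset.card_insert_of_notMem,
        Finset.card_insert_of_notMem, Finset.card_singleton]
      all_goals
        simp only [Finset.mem_insert, Finset.mem_singleton]
        grind
    obtain ⟨a, ha, v, hv, b, hb, hav, hvb, -, hD⟩ := h.exists_isolated (by omega)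
    have := ih (S.erase v).card (by rw [Finset.card_erase_of_mem hv]; omega)
      (h.erase (D' := D.erase (a, b)) ha hb hav hvb hD (Finset.erase_subset _ _) (by simp)) rfl
    have := Finset.card_erase_of_mem hv
    have := Finset.pred_card_le_card_erase (s := D) (a := (a, b))
    omega

variable [Fintype α]

/-- The triangles cut out by the diagonals `D` of the polygon on `S`. -/
noncomputable def chordTriangles (S : Finset α) (D : Finset (α × α)) : Finset (Finset α) :=
  Finset.univ.filter fun s =>
    s ⊆ S ∧ s.card = 3 ∧ ∀ i ∈ s, ∀ j ∈ s, i < j → IsChord S D i j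

lemma chordTriangles_ear {S : Finset α} {D : Finset (α × α)} {a v b : α}
    (ha : a ∈ S) (hv : v ∈ S) (hb : b ∈ S) (hav : a < v) (hvb : v < b)
    (hgap : ∀ x ∈ S, x ≠ v → x ≤ a ∨ b ≤ x)
    (hab : (a, b) ∈ D ∨ ∀ x ∈ S, a ≤ x ∧ x ≤ b)
    (hD : ∀ d ∈ D, d.1 ≠ v ∧ d.2 ≠ v) :
    chordTriangles S D =
      insert {a, v, b} (chordTriangles (S.erase v) (D.erase (a, b))) := by
  have hchord : ∀ i ∈ S, ∀ j ∈ S, i ≠ v → j ≠ v → i < j →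
      (IsChord S D i j ↔ IsChord (S.erase v) (D.erase (a, b)) i j) := by
    intro i hi j hj hiv hjv hij
    have hgi := hgap i hi hiv
    have hgj := hgap j hj hjv
    simp only [IsChord, Finset.mem_erase, ne_eq, Prod.mk.injEq]
    by_cases hiab : i = a ∧ j = b
    · obtain ⟨rfl, rfl⟩ := hiab
      refine iff_of_true (hab.imp_right Or.inr) (Or.inr (Or.inl fun x hx => hgap x hx.2 hx.1))
    · simp only [hiab, not_false_eq_true, true_and]
      refine or_congr_right (or_congr ⟨fun h x hx => h x hx.2, fun h x hx => ?_⟩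
        ⟨fun h x hx => h x hx.2, fun h x hx => ?_⟩)
      · by_cases hxv : x = v
        · have := h a ⟨hav.ne, ha⟩
          have := h b ⟨hvb.ne', hb⟩
          grind
        · exact h x ⟨hxv, hx⟩
      · by_cases hxv : x = v
        · have := h a ⟨hav.ne, ha⟩
          have := h b ⟨hvb.ne', hb⟩
          grind
        · exact h x ⟨hxv, hx⟩
  have hleft : ∀ i ∈ S, i < v → IsChord S D i v → i = a := by
    intro i hi hiv hc
    have := hgap i hi hiv.ne
    rcases hc with hc | hc | hc
    · exact absurd rfl (hD _ hc).2
    · have := hc a ha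
      grind
    · have := hc b hb
      grind
  have hright : ∀ j ∈ S, v < j → IsChord S D v j → j = b := by
    intro j hj hvj hc
    have := hgap j hj hvj.ne'
    rcases hc with hc | hc | hc
    · exact absurd rfl (hD _ hc).1
    · have := hc b hb
      grind
    · have := hc a ha
      grind
  ext s
  simp only [chordTriangles, Finset.mem_insert, Finset.mem_filter, Finset.mem_univ, true_and]
  by_cases hvs : v ∈ s
  · have hno : ¬s ⊆ S.erase v := fun h => by simpa using h hvs
    simp only [hno, false_and, or_false]
    have hcard : ({a, v, b} : Finset α).card = 3 :=
      Finset.card_eq_three.2 ⟨a, v, b, hav.ne, (hav.trans hvb).ne, hvb.ne, rfl⟩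
    constructor
    · rintro ⟨hsS, hs, hc⟩
      refine Finset.eq_of_subset_of_card_le (fun x hx => ?_) (by omega)
      simp only [Finset.mem_insert, Finset.mem_singleton]
      rcases lt_trichotomy x v with hlt | rfl | hlt
      · exact Or.inl (hleft x (hsS hx) hlt (hc x hx v hvs hlt))
      · exact Or.inr (Or.inl rfl)
      · exact Or.inr (Or.inr (hright x (hsS hx) hlt (hc v hvs x hx hlt)))
    · rintro rfl
      refine ⟨?_, hcard, ?_⟩
      · intro x
        simp only [Finset.mem_insert, Finset.mem_singleton]
        rintro (rfl | rfl | rfl) <;> assumption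
      · have h1 : IsChord S D a v := Or.inr (Or.inl fun x hx => by
          have := hgap x hx
          grind)
        have h2 : IsChord S D v b := Or.inr (Or.inl fun x hx => by
          have := hgap x hx
          grind)
        have h3 : IsChord S D a b := hab.imp_right Or.inr
        simp only [Finset.mem_insert, Finset.mem_singleton]
        rintro i (rfl | rfl | rfl) j (rfl | rfl | rfl) hij <;>
          first
          | assumption
          | exact absurd hij (lt_irrefl _)
          | exact absurd hij (hav.trans hvb).not_gt
          | exact absurd hij hav.not_gt
          | exact absurd hij hvb.not_gt
  · have hne : s ≠ {a, v, b} := fun e => hvs (by simp [e])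
    simp only [hne, false_or, Finset.subset_erase, hvs, not_false_eq_true, and_true]
    refine and_congr_right fun hsS => and_congr_right fun _ => ?_
    refine forall₂_congr fun i hi => forall₂_congr fun j hj => forall_congr' fun hij => ?_
    exact hchord i (hsS hi) j (hsS hj) (fun e => hvs (e ▸ hi)) (fun e => hvs (e ▸ hj)) hij

theorem NoncrossingOn.earBuilt {S : Finset α} {D : Finset (α × α)} (h : NoncrossingOn S D)
    (hS : 2 ≤ S.card) (hD : D.card = S.card - 3) : EarBuilt S (chordTriangles S D) := by
  induction hn : S.card using Nat.strong_induction_on generalizing S D with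
  | _ n ih =>
    rcases hS.eq_or_lt with h2 | h3
    · have : chordTriangles S D = ∅ := by
        rw [Finset.eq_empty_iff_forall_notMem]
        intro s hs
        simp only [chordTriangles, Finset.mem_filter] at hs
        have := Finset.card_le_card hs.2.1
        omega
      rw [this]
      obtain ⟨a, b, hab, rfl⟩ := Finset.card_eq_two.1 h2.symm
      rcases hab.lt_or_gt with hlt | hlt
      · exact EarBuilt.digon a b hlt
      · rw [Finset.pair_comm]
        exact EarBuilt.digon b a hlt
    obtain ⟨a, ha, v, hv, b, hb, hav, hvb, hab, hiso⟩ := h.exists_isolated h3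
    have hcard := Finset.card_erase_of_mem hv
    have hgap : ∀ x ∈ S, x ≠ v → x ≤ a ∨ b ≤ x := by
      intro x hx hxv
      by_contra! hcon
      have hle := (h.erase (D' := D) ha hb hav hvb hiso subset_rfl
        fun _ => ⟨x, hx, hxv, hcon⟩).card_le
      have hsub : ({a, b, v, x} : Finset α) ⊆ S := by
        intro z
        simp only [Finset.mem_insert, Finset.mem_singleton]
        rintro (rfl | rfl | rfl | rfl) <;> assumption
      have h4 : 4 ≤ S.card := by
        refine le_trans (le_of_eq ?_) (Finset.card_le_card hsub)
        rw [Finset.card_insert_of_notMem, Finset.card_insert_of_notMem,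
          Finset.card_insert_of_notMem, Finset.card_singleton]
        all_goals
          simp only [Finset.mem_insert, Finset.mem_singleton]
          grind
      omega
    have h' := h.erase (D' := D.erase (a, b)) ha hb hav hvb hiso (Finset.erase_subset _ _)
      (by simp)
    have hle := h'.card_le
    have hpred := Finset.pred_card_le_card_erase (s := D) (a := (a, b))
    have hle' := Finset.card_le_card (Finset.erase_subset (a, b) D)
    have hE := ih (S.erase v).card (by omega) h' (by omega) (by omega) rfl
    rw [chordTriangles_ear ha hv hb hav hvb hgap hab fun d hd => ⟨(hiso d hd).1, (hiso d hd).2.1⟩]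
    have := EarBuilt.ear _ _ a v b hE
      ⟨Finset.mem_erase.2 ⟨hav.ne, ha⟩, Finset.mem_erase.2 ⟨hvb.ne', hb⟩, hav.trans hvb,
        fun z hz => hgap z (Finset.mem_of_mem_erase hz) (Finset.ne_of_mem_erase hz)⟩ hav hvb
    rwa [Finset.insert_erase hv] at this

end Dissection

lemma natCard_injective_incident {α : Type*} [Fintype α] (I : Finset α)
    (B : Finset (Finset α)) :
    Nat.card {f : I → {s // s ∈ B} //
      Function.Injective f ∧ ∀ v, (v : α) ∈ (f v : Finset α)} = (vertexMatchings I B).card := by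
  rw [← Nat.card_eq_finsetCard]
  refine Nat.card_congr
    { toFun := fun f => ⟨fun v => if h : v ∈ I then (f.1 ⟨v, h⟩ : Finset α) else ∅, ?_⟩
      invFun := fun f => ⟨fun v => ⟨f.1 v, ((mem_vertexMatchings.1 f.2).2.1 v v.2).1⟩, ?_, ?_⟩
      left_inv := ?_
      right_inv := ?_ }
  · rw [mem_vertexMatchings]
    refine ⟨fun v hv w hw e => ?_, fun v hv => ?_, fun v hv => dif_neg hv⟩
    · simp only [dif_pos hv, dif_pos hw] at e
      exact congrArg Subtype.val (f.2.1 (Subtype.ext e))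
    · simp only [dif_pos hv]
      exact ⟨(f.1 ⟨v, hv⟩).2, f.2.2 ⟨v, hv⟩⟩
  · intro v w e
    exact Subtype.ext ((mem_vertexMatchings.1 f.2).1 v v.2 w w.2 (congrArg Subtype.val e))
  · exact fun v => ((mem_vertexMatchings.1 f.2).2.1 v v.2).2
  · intro f
    ext v : 3
    simp
  · intro f
    ext v : 2
    by_cases h : v ∈ I
    · simp [h]
    · simp [h, (mem_vertexMatchings.1 f.2).2.2 v h]

section ZModOrder

variable {n : ℕ} [NeZero n]

/-- The linear order on `ZMod n` given by the representatives in `[0, n)`. -/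
noncomputable abbrev ZMod.valLinearOrder (n : ℕ) [NeZero n] : LinearOrder (ZMod n) :=
  LinearOrder.lift' ZMod.val (ZMod.val_injective n)

attribute [local instance] ZMod.valLinearOrder

lemma ZMod.lt_iff_val_lt {i j : ZMod n} : i < j ↔ i.val < j.val := Iff.rfl

lemma ZMod.le_iff_val_le {i j : ZMod n} : i ≤ j ↔ i.val ≤ j.val := Iff.rfl

lemma ZMod.val_sub_eq_ite (k i : ZMod n) :
    (k - i).val = if i.val ≤ k.val then k.val - i.val else n + k.val - i.val := by
  split_ifs with h
  · exact ZMod.val_sub h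
  · have hi := i.val_lt
    have e : k - i = ((n + k.val - i.val : ℕ) : ZMod n) := by
      rw [Nat.cast_sub (by omega)]
      simp
    rw [e, ZMod.val_natCast, Nat.mod_eq_of_lt (by omega)]

lemma strictInterval_eq_cycArc {i j : ZMod n} (hij : i ≠ j) :
    strictInterval n i j = cycArc Finset.univ i j := by
  ext k
  have hij' : i.val ≠ j.val := fun h => hij (ZMod.val_injective n h)
  have hki : k ≠ i ↔ k.val ≠ i.val := (ZMod.val_injective n).ne_iff.symm
  have hkj : k ≠ j ↔ k.val ≠ j.val := (ZMod.val_injective n).ne_iff.symm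
  simp only [strictInterval, cycArc, CycBetween, Finset.mem_filter, Finset.mem_univ, true_and,
    ZMod.lt_iff_val_lt, ZMod.val_sub_eq_ite, hki, hkj]
  have := i.val_lt
  have := j.val_lt
  have := k.val_lt
  split_ifs <;> omega

lemma matchNum_eq_card_vertexMatchings (T : PolygonTriangulation n) {i j : ZMod n}
    (hij : i ≠ j) :
    matchNum T i j = (vertexMatchings (cycArc Finset.univ i j) (triangles T)).card := by
  rw [matchNum, strictInterval_eq_cycArc hij, natCard_injective_incident]

lemma PolygonTriangulation.noncrossingOn (T : PolygonTriangulation n) :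
    NoncrossingOn Finset.univ T.diags where
  left_mem _ _ := Finset.mem_univ _
  right_mem _ _ := Finset.mem_univ _
  exists_between d hd := by
    have h := (T.not_boundary d hd).1
    have := d.2.val_lt
    have e : ((d.1.val + 1 : ℕ) : ZMod n).val = d.1.val + 1 :=
      ZMod.val_cast_of_lt (by omega)
    refine ⟨((d.1.val + 1 : ℕ) : ZMod n), Finset.mem_univ _, ?_, ?_⟩ <;>
      rw [ZMod.lt_iff_val_lt, e] <;> omega
  exists_outside d hd := by
    have h := (T.not_boundary d hd).2
    have := d.2.val_lt
    by_cases h0 : d.1.val = 0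
    · refine ⟨((n - 1 : ℕ) : ZMod n), Finset.mem_univ _, Or.inr ?_⟩
      rw [ZMod.lt_iff_val_lt, ZMod.val_cast_of_lt (by omega)]
      omega
    · refine ⟨0, Finset.mem_univ _, Or.inl ?_⟩
      rw [ZMod.lt_iff_val_lt, ZMod.val_zero]
      omega
  not_crossing := T.noncrossing

lemma isTriEdge_comm (T : PolygonTriangulation n) {i j : ZMod n} :
    IsTriEdge T i j ↔ IsTriEdge T j i := by
  unfold IsTriEdge
  tauto

lemma ZMod.val_add_one_eq_ite (hn : 2 ≤ n) (i : ZMod n) :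
    (i + 1).val = if i.val + 1 = n then 0 else i.val + 1 := by
  have := i.val_lt
  rw [ZMod.val_add, ZMod.val_one'' (by omega)]
  split_ifs with h
  · rw [h, Nat.mod_self]
  · exact Nat.mod_eq_of_lt (by omega)

lemma isTriEdge_iff_isChord (hn : 2 ≤ n) (T : PolygonTriangulation n) {i j : ZMod n}
    (hij : i < j) : IsTriEdge T i j ↔ IsChord Finset.univ T.diags i j := by
  have hi := i.val_lt
  have hj := j.val_lt
  rw [ZMod.lt_iff_val_lt] at hij
  have hji : (j, i) ∉ T.diags := fun h => absurd (T.lt_of_mem _ h) (by simpa using hij.le)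
  simp only [IsTriEdge, IsChord, hji, false_or, Finset.mem_univ, true_imp_iff,
    ← (ZMod.val_injective n).eq_iff, ZMod.val_add_one_eq_ite hn, ZMod.le_iff_val_le]
  refine or_congr_right (or_congr ⟨fun h x => ?_, fun h => ?_⟩ ⟨fun h x => ?_, fun h => ?_⟩)
  · split_ifs at h <;> omega
  · have := h ((i.val + 1 : ℕ) : ZMod n)
    rw [ZMod.val_cast_of_lt (by omega)] at this
    split_ifs <;> omega
  · have := x.val_lt
    split_ifs at h <;> omega
  · have h0 := (h 0).1
    have h1 := (h ((n - 1 : ℕ) : ZMod n)).2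
    rw [ZMod.val_zero] at h0
    rw [ZMod.val_cast_of_lt (by omega)] at h1
    split_ifs <;> omega

lemma triangles_eq_chordTriangles (hn : 2 ≤ n) (T : PolygonTriangulation n) :
    triangles T = chordTriangles Finset.univ T.diags := by
  ext s
  simp only [triangles, chordTriangles, Finset.mem_filter, Finset.mem_univ, true_and,
    Finset.subset_univ]
  refine and_congr_right fun _ => ⟨fun h i hi j hj hij => ?_, fun h i hi j hj hij => ?_⟩
  · exact (isTriEdge_iff_isChord hn T hij).1 (h i hi j hj hij.ne)
  · rcases hij.lt_or_gt with hlt | hlt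
    · exact (isTriEdge_iff_isChord hn T hlt).2 (h i hi j hj hlt)
    · exact (isTriEdge_comm T).2 ((isTriEdge_iff_isChord hn T hlt).2 (h j hj i hi hlt))

lemma PolygonTriangulation.earBuilt (hn : 2 ≤ n) (T : PolygonTriangulation n) :
    EarBuilt Finset.univ (triangles T) := by
  rw [triangles_eq_chordTriangles hn]
  refine T.noncrossingOn.earBuilt ?_ ?_ <;> rw [Finset.card_univ, ZMod.card]
  · exact hn
  · exact T.card_diags

lemma det_matchNum (hn : 2 ≤ n) (T : PolygonTriangulation n) :
    (Matrix.of fun i j : ZMod n =>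
        if i = j then (0 : ℤ) else (matchNum T i j : ℤ)).det = -(-2) ^ (n - 2) := by
  have h := (T.earBuilt hn).det_matchingMatrix
  rw [Finset.card_univ, ZMod.card] at h
  rw [← h]
  congr 1
  ext i j
  simp only [matchingMatrix, Matrix.of_apply, Finset.mem_univ, and_self, if_true]
  split_ifs with hij
  · rfl
  · rw [matchNum_eq_card_vertexMatchings T hij]

end ZModOrder

/-- Broline–Crowe–Isaacs determinant: the symmetric matrix of matching numbers of a
triangulation of a convex `n`-gon has determinant `-(-2)^(n-2)`. -/
theorem bci_determinant (n : ℕ) [NeZero n] (hn : 4 ≤ n) (T : PolygonTriangulation n) :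
    (Matrix.of fun i j : ZMod n =>
        if i = j then (0 : ℤ) else (matchNum T i j : ℤ)).det = -(-2) ^ (n - 2) :=
  det_matchNum (by omega) T
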